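/- arXiv:2407.03574 — 5 statements merged into one kernel-verified Lean document; each statement's English description precedes it below -/
import Mathlib

section
/- Let (Ω, d) be a metric space and let f, g : Ω → [0, ∞) be two functions. For a function u : Ω → [0, ∞) define its Hartigan merge height by m_u(x, y) = sup{ inf_{z ∈ C} u(z) : C ⊆ Ω connected, x ∈ C, y ∈ C }. Then for all x, y ∈ Ω, |m_f(x, y) − m_g(x, y)| ≤ ‖f − g‖_∞; consequently, the merge distortion distance d_M between the Hartigan dendrograms of f and g, defined as sup_{x,y ∈ Ω} |m_f(x,y) − m_g(x,y)|, is at most ‖f − g‖_∞. -/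
open Set Topology ENNReal

/-- The Hartigan merge height of two points `x, y` for a function `u : Ω → [0, ∞)`:
the supremum, over all connected sets `C` containing both `x` and `y`, of the
infimum of `u` over `C`.  (The empty set is considered disconnected, i.e. we use
`IsConnected`, which requires nonemptiness.) -/
noncomputable def mergeHeight {Ω : Type*} [MetricSpace Ω] (u : Ω → NNReal) (x y : Ω) : ℝ≥0∞ :=
  ⨆ C ∈ {C : Set Ω | IsConnected C ∧ x ∈ C ∧ y ∈ C}, ⨅ z ∈ C, (u z : ℝ≥0∞)

/-- The absolute difference `|a - b|` in `ℝ≥0∞`. -/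
noncomputable def absDiff (a b : ℝ≥0∞) : ℝ≥0∞ := (a - b) ⊔ (b - a)

theorem mergeHeight_sub_le_aux {Ω : Type*} [MetricSpace Ω] (f g : Ω → NNReal) (D : ℝ≥0∞)
    (hD : ∀ z, edist (f z) (g z) ≤ D) (x y : Ω) :
    mergeHeight f x y - mergeHeight g x y ≤ D := by
  rw [tsub_le_iff_left]
  unfold mergeHeight
  refine iSup₂_le fun C hC => ?_
  refine le_trans ?_ (add_le_add_left
    (le_iSup₂ (f := fun (C : Set Ω) (_ : C ∈ {C : Set Ω | IsConnected C ∧ x ∈ C ∧ y ∈ C}) =>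
      ⨅ z ∈ C, (g z : ℝ≥0∞)) C hC) D)
  rw [← tsub_le_iff_right]
  refine le_iInf₂ fun z hz => ?_
  rw [tsub_le_iff_left]
  refine (iInf₂_le z hz).trans ?_
  rw [← tsub_le_iff_right]
  refine le_trans ?_ (hD z)
  rw [edist_nndist, NNReal.nndist_eq, ← ENNReal.coe_sub]
  exact ENNReal.coe_le_coe.2 (le_max_left _ _)

/-- For two functions `f, g : Ω → [0, ∞)` on a metric space, the Hartigan merge
heights satisfy `|m_f(x,y) - m_g(x,y)| ≤ ‖f - g‖_∞` for all `x, y`; consequently, the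
merge distortion distance between the Hartigan dendrograms of `f` and `g`, namely
`sup_{x,y} |m_f(x,y) - m_g(x,y)|`, is at most `‖f - g‖_∞`. -/
theorem merge_distortion_le_sup_norm {Ω : Type*} [MetricSpace Ω] (f g : Ω → NNReal) :
    (∀ x y : Ω, absDiff (mergeHeight f x y) (mergeHeight g x y) ≤ ⨆ z : Ω, edist (f z) (g z)) ∧
    (⨆ x : Ω, ⨆ y : Ω, absDiff (mergeHeight f x y) (mergeHeight g x y))
      ≤ ⨆ z : Ω, edist (f z) (g z) := by
  have key : ∀ x y : Ω, absDiff (mergeHeight f x y) (mergeHeight g x y)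
      ≤ ⨆ z : Ω, edist (f z) (g z) := fun x y =>
    sup_le
      (mergeHeight_sub_le_aux f g _ (fun z => le_iSup (fun z => edist (f z) (g z)) z) x y)
      (mergeHeight_sub_le_aux g f _ (fun z => by
        rw [edist_comm]; exact le_iSup (fun z => edist (f z) (g z)) z) x y)
  exact ⟨key, iSup₂_le key⟩
end

section
/- Suppose (Ω, d) is a metric space in which all closed and bounded sets are compact and which has the internally connected partition property. Let f : Ω → [0, ∞) be continuous, with all upper level sets {x : f(x) ≥ λ}, λ > 0, bounded, and such that the upper λ-level set is connected when λ > 0 is small enough. Then for every η > 0 there exists g ∈ F_int with ‖f − g‖_∞ ≤ η; in particular, there is a sequence (f_n) ⊆ F_int converging uniformly to f. -/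
open Set Topology Bornology

/-- Two sets are neighbors if the interior of the union of their closures is connected
(the empty set being considered disconnected). -/
def Neighbors {Ω : Type*} [TopologicalSpace Ω] (A B : Set Ω) : Prop :=
  IsConnected (interior (closure A ∪ closure B))

/-- The piecewise constant function `f = ∑ i, lam i * 1_{A i}`. -/
noncomputable def pwConst {Ω : Type*} (m : ℕ) (A : Fin m → Set Ω) (lam : Fin m → ℝ) :
    Ω → ℝ :=
  fun x => ∑ i, Set.indicator (A i) (fun _ => lam i) x

/-- Membership in the class `F`: `f = ∑_{i=1}^m lam i * 1_{A i}` where each `lam i > 0`,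
the `A i` are pairwise disjoint, bounded, connected sets with connected interior, and
`supp f = ⋃ i, closure (A i)` has connected interior. -/
def MemF {Ω : Type*} [MetricSpace Ω] (m : ℕ) (A : Fin m → Set Ω) (lam : Fin m → ℝ) : Prop :=
  (∀ i, 0 < lam i) ∧
  (Pairwise fun i j => Disjoint (A i) (A j)) ∧
  (∀ i, IsBounded (A i)) ∧
  (∀ i, IsConnected (A i)) ∧
  (∀ i, IsConnected (interior (A i))) ∧
  IsConnected (interior (⋃ i, closure (A i)))

/-- The neighborhood `N(A i)` of a region: the union of all regions `A j` that are
neighbors of `A i`. -/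
def regionNbhd {Ω : Type*} [TopologicalSpace Ω] {m : ℕ} (A : Fin m → Set Ω) (i : Fin m) :
    Set Ω :=
  ⋃ j ∈ {j | Neighbors (A i) (A j)}, A j

/-- A set `C` satisfies the axioms (A1), (A2), (A3) for `f = ∑ i, lam i * 1_{A i}`:
(A2) `C = ⋃_{i ∈ I} A i` for some `I`;
(A1) any two regions of `C` are joined by a chain of neighboring regions inside `C`;
(A3) `inf_{x ∈ C} f(x) > sup_{x ∈ N(C) ∖ C} f(x)` where `N(C) = ⋃_{i ∈ I} N(A i)`. -/
def SatisfiesAxioms {Ω : Type*} [MetricSpace Ω] (m : ℕ) (A : Fin m → Set Ω)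
    (lam : Fin m → ℝ) (C : Set Ω) : Prop :=
  ∃ I : Set (Fin m),
    C = ⋃ i ∈ I, A i ∧
    (∀ i ∈ I, ∀ j ∈ I,
      Relation.ReflTransGen (fun a b => a ∈ I ∧ b ∈ I ∧ Neighbors (A a) (A b)) i j) ∧
    sSup (pwConst m A lam '' ((⋃ i ∈ I, regionNbhd A i) \ C))
      < sInf (pwConst m A lam '' C)

/-- The collection `{A i}` has the internally connected property: whenever the union of
the closures of two of its members is connected, the interior of that union is
connected. -/
def InternallyConnectedFamily {Ω : Type*} [TopologicalSpace Ω] {m : ℕ}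
    (A : Fin m → Set Ω) : Prop :=
  ∀ i j, IsConnected (closure (A i) ∪ closure (A j)) →
    IsConnected (interior (closure (A i) ∪ closure (A j)))

/-- The internally connected property for a collection of sets. -/
def InternallyConnectedColl {Ω : Type*} [TopologicalSpace Ω] (𝒜 : Set (Set Ω)) : Prop :=
  ∀ A ∈ 𝒜, ∀ B ∈ 𝒜, IsConnected (closure A ∪ closure B) →
    IsConnected (interior (closure A ∪ closure B))

/-- `Ω` has the internally connected partition property: `Ω` is connected and for every
`r > 0` there is a locally finite partition of `Ω` having the internally connected
property, whose parts are connected with connected interior and of diameter at most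
`r`. -/
def HasICPartitionProperty (Ω : Type*) [MetricSpace Ω] : Prop :=
  IsConnected (Set.univ : Set Ω) ∧
  ∀ r : ℝ, 0 < r → ∃ 𝒜 : Set (Set Ω),
    (∀ A ∈ 𝒜, IsConnected A ∧ IsConnected (interior A) ∧
      EMetric.diam A ≤ ENNReal.ofReal r) ∧
    (𝒜.Pairwise fun A B => Disjoint A B) ∧
    ⋃₀ 𝒜 = Set.univ ∧
    (∀ x : Ω, ∃ U ∈ nhds x, {A ∈ 𝒜 | (A ∩ U).Nonempty}.Finite) ∧
    InternallyConnectedColl 𝒜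

/-- `g` belongs to the class `F_int`: it is a finite sum `∑ i, lam i * 1_{A i}` with
`lam i > 0`, the `A i` pairwise disjoint, bounded, connected with connected interior,
`⋃ i, closure (A i)` with connected interior, and `{A i}` has the internally connected
property. -/
def MemFint {Ω : Type*} [MetricSpace Ω] (g : Ω → ℝ) : Prop :=
  ∃ (m : ℕ) (A : Fin m → Set Ω) (lam : Fin m → ℝ),
    MemF m A lam ∧ InternallyConnectedFamily A ∧ g = pwConst m A lam


theorem aux_chain {X ι : Type*} [TopologicalSpace X] [Finite ι] (C : ι → Set X)
    (hC : ∀ i, IsClosed (C i)) (hne : ∀ i, (C i).Nonempty) (hU : IsPreconnected (⋃ i, C i))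
    (i j : ι) : Relation.ReflTransGen (fun a b => (C a ∩ C b).Nonempty) i j := by
  by_contra hj
  set T : Set ι := {k | Relation.ReflTransGen (fun a b => (C a ∩ C b).Nonempty) i k} with hT
  have h1 : IsClosed (⋃ k ∈ T, C k) := (Set.toFinite T).isClosed_biUnion fun k _ => hC k
  have h2 : IsClosed (⋃ k ∈ Tᶜ, C k) := (Set.toFinite Tᶜ).isClosed_biUnion fun k _ => hC k
  have := (isPreconnected_closed_iff.1 hU) _ _ h1 h2 ?_ ?_ ?_
  · obtain ⟨x, -, hx1, hx2⟩ := this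
    simp only [mem_iUnion] at hx1 hx2
    obtain ⟨a, ha, hxa⟩ := hx1
    obtain ⟨b, hb, hxb⟩ := hx2
    exact hb (Relation.ReflTransGen.tail ha ⟨x, hxa, hxb⟩)
  · intro x hx
    obtain ⟨k, hk⟩ := mem_iUnion.1 hx
    by_cases h : k ∈ T
    · exact Or.inl (mem_biUnion h hk)
    · exact Or.inr (mem_biUnion (show k ∈ Tᶜ from h) hk)
  · obtain ⟨x, hx⟩ := hne i
    exact ⟨x, mem_iUnion.2 ⟨i, hx⟩, mem_biUnion (show i ∈ T from Relation.ReflTransGen.refl) hx⟩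
  · obtain ⟨x, hx⟩ := hne j
    exact ⟨x, mem_iUnion.2 ⟨j, hx⟩, mem_biUnion (show j ∈ Tᶜ from hj) hx⟩

theorem aux_interior {X ι : Type*} [TopologicalSpace X] [BaireSpace X] [Finite ι] [Nonempty ι]
    (C : ι → Set X)
    (hC : ∀ i, IsClosed (C i)) (hconn : ∀ i, IsConnected (C i))
    (hint : ∀ i, (interior (C i)).Nonempty)
    (hU : IsPreconnected (⋃ i, C i))
    (hIC : ∀ i j, IsConnected (C i ∪ C j) → IsConnected (interior (C i ∪ C j))) :
    IsConnected (interior (⋃ i, C i)) := by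
  classical
  let V : ι → Set X := fun i => ⋃ j : {j // (C i ∩ C j).Nonempty}, interior (C i ∪ C j)
  have hsub : ∀ i j, (C i ∩ C j).Nonempty → interior (C i ∪ C j) ⊆ V i := fun i j h =>
    subset_iUnion (fun j : {j // (C i ∩ C j).Nonempty} => interior (C i ∪ C j)) ⟨j, h⟩
  have hNN : ∀ i j, (C i ∩ C j).Nonempty → IsConnected (interior (C i ∪ C j)) := fun i j h =>
    hIC i j ((hconn i).union h (hconn j))
  have hVi : ∀ i, interior (C i) ⊆ V i := fun i => by
    have := hsub i i (by simpa using (hconn i).nonempty)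
    simpa using this
  have hV : ∀ i, IsConnected (V i) := fun i => by
    obtain ⟨x, hx⟩ := hint i
    refine ⟨⟨x, hVi i hx⟩, isPreconnected_iUnion ⟨x, ?_⟩ fun j => (hNN i j j.2).isPreconnected⟩
    exact mem_iInter.2 fun j => interior_mono subset_union_left hx
  have hW : IsConnected (⋃ i, V i) := by
    refine IsConnected.iUnion_of_reflTransGen hV fun i j => ?_
    refine Relation.ReflTransGen.mono ?_ _ _ (aux_chain C hC (fun i => (hconn i).nonempty) hU i j)
    intro a b hab
    obtain ⟨x, hx⟩ := (hNN a b hab).nonempty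
    refine ⟨x, hsub a b hab hx, hsub b a (by rwa [inter_comm]) (by rwa [union_comm])⟩
  refine hW.subset_closure ?_ ?_
  · refine iUnion_subset fun i => iUnion_subset fun j => interior_mono ?_
    exact union_subset (subset_iUnion C i) (subset_iUnion C j)
  · intro x hx
    rw [mem_closure_iff]
    intro O hO hxO
    let D : Option ι → Set X := fun o => o.elim (interior (⋃ i, C i))ᶜ C
    have hD : Dense (⋃ o, interior (D o)) := by
      refine dense_iUnion_interior_of_closed (f := D) ?_ ?_
      · rintro (_ | i)
        · exact isOpen_interior.isClosed_compl
        · exact hC i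
      · refine eq_univ_of_forall fun y => ?_
        by_cases hy : y ∈ interior (⋃ i, C i)
        · obtain ⟨i, hi⟩ := mem_iUnion.1 (interior_subset hy)
          exact mem_iUnion.2 ⟨some i, hi⟩
        · exact mem_iUnion.2 ⟨none, hy⟩
    obtain ⟨y, ⟨hyO, hyU⟩, hy⟩ :=
      hD.inter_open_nonempty (O ∩ interior (⋃ i, C i)) (hO.inter isOpen_interior) ⟨x, hxO, hx⟩
    obtain ⟨o, ho⟩ := mem_iUnion.1 hy
    rcases o with _ | i
    · exact absurd hyU (interior_subset ho)
    · exact ⟨y, hyO, mem_iUnion.2 ⟨i, hVi i ho⟩⟩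

theorem aux_approx {Ω : Type*} [MetricSpace Ω]
    (hHB : ∀ s : Set Ω, IsClosed s → IsBounded s → IsCompact s)
    (hICPP : HasICPartitionProperty Ω)
    (f : Ω → ℝ) (hf_cont : Continuous f) (hf_nonneg : ∀ x, 0 ≤ f x)
    (hf_bdd : ∀ lam : ℝ, 0 < lam → IsBounded {x | lam ≤ f x})
    (hf_conn : ∃ lam₀ > (0 : ℝ), ∀ lam : ℝ, 0 < lam → lam ≤ lam₀ →
      IsConnected {x | lam ≤ f x}) (η : ℝ) (hη : 0 < η) :
    ∃ g : Ω → ℝ, MemFint g ∧ ∀ x, |f x - g x| ≤ η := by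
  classical
  haveI : ProperSpace Ω := ⟨fun x r => hHB _ Metric.isClosed_closedBall Metric.isBounded_closedBall⟩
  have hcpt : ∀ lam : ℝ, 0 < lam → IsCompact {x | lam ≤ f x} := fun lam h =>
    hHB _ (isClosed_le continuous_const hf_cont) (hf_bdd lam h)
  have htend : Filter.Tendsto f (Filter.cocompact Ω) (𝓝 0) := by
    rw [Metric.tendsto_nhds]
    intro ε hε
    filter_upwards [(hcpt ε hε).compl_mem_cocompact] with x hx
    simp only [mem_compl_iff, mem_setOf_eq, not_le] at hx
    rw [Real.dist_eq, sub_zero, abs_of_nonneg (hf_nonneg x)]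
    exact hx
  have huc : UniformContinuous f := hf_cont.uniformContinuous_of_tendsto_cocompact htend
  obtain ⟨δ, hδ, hδf⟩ := Metric.uniformContinuous_iff.1 huc η hη
  obtain ⟨l₀, hl₀, hconn⟩ := hf_conn
  set l := min η l₀ with hl
  have hlpos : 0 < l := lt_min hη hl₀
  set K := {x | l ≤ f x} with hK
  have hKc : IsConnected K := hconn l hlpos (min_le_right _ _)
  obtain ⟨𝒜, hA, hdisj, hcov, hlf, hIC⟩ := hICPP.2 (δ / 2) (by positivity)
  have hdist : ∀ A ∈ 𝒜, ∀ x ∈ A, ∀ y ∈ A, dist x y < δ := by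
    intro A hAA x hx y hy
    have h1 := (EMetric.edist_le_diam_of_mem hx hy).trans (hA A hAA).2.2
    rw [edist_dist, ENNReal.ofReal_le_ofReal_iff (by positivity)] at h1
    linarith
  let S : Set (Set Ω) := {A ∈ 𝒜 | (A ∩ K).Nonempty}
  have hSfin : S.Finite := by
    choose U hU hUf using hlf
    obtain ⟨t, -, ht⟩ := (hcpt l hlpos).elim_nhds_subcover U (fun x _ => hU x)
    refine (t.finite_toSet.biUnion fun x _ => hUf x).subset ?_
    rintro A ⟨hA1, y, hyA, hyK⟩
    obtain ⟨x, hx, hyx⟩ := mem_iUnion₂.1 (ht hyK)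
    exact mem_biUnion (show x ∈ (t : Set Ω) from hx) ⟨hA1, y, hyA, hyx⟩
  haveI : Finite S := hSfin
  obtain ⟨m, ⟨e⟩⟩ := Finite.exists_equiv_fin S
  let A : Fin m → Set Ω := fun i => (e.symm i : Set Ω)
  have hAm : ∀ i, A i ∈ 𝒜 := fun i => (e.symm i).2.1
  have hAK : ∀ i, (A i ∩ K).Nonempty := fun i => (e.symm i).2.2
  have hKA : ∀ x ∈ K, ∃ i, x ∈ A i := by
    intro x hx
    have : x ∈ ⋃₀ 𝒜 := hcov ▸ mem_univ x
    obtain ⟨B, hB, hxB⟩ := this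
    refine ⟨e ⟨B, hB, x, hxB, hx⟩, ?_⟩
    simpa [A] using hxB
  have hAd : Pairwise fun i j => Disjoint (A i) (A j) := by
    intro i j hij
    refine hdisj (hAm i) (hAm j) fun h => hij ?_
    exact e.symm.injective (Subtype.ext h)
  choose p hpA hpK using hAK
  refine ⟨pwConst m A (fun i => f (p i)), ⟨m, A, fun i => f (p i), ⟨?_, hAd, ?_, ?_, ?_, ?_⟩, ?_, rfl⟩, ?_⟩
  · exact fun i => hlpos.trans_le (hpK i)
  · intro i
    exact Metric.isBounded_iff.2 ⟨δ, fun x hx y hy => (hdist _ (hAm i) x hx y hy).le⟩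
  · exact fun i => (hA _ (hAm i)).1
  · exact fun i => (hA _ (hAm i)).2.1
  · obtain ⟨x₀, hx₀⟩ := hKc.nonempty
    haveI : Nonempty (Fin m) := ⟨(hKA x₀ hx₀).choose⟩
    refine aux_interior (fun i => closure (A i)) (fun i => isClosed_closure)
      (fun i => (hA _ (hAm i)).1.closure) 
      (fun i => (hA _ (hAm i)).2.1.nonempty.mono (interior_mono subset_closure)) ?_
      (fun i j => hIC _ (hAm i) _ (hAm j))
    have : (⋃ i, closure (A i)) = ⋃ i, (K ∪ closure (A i)) := by
      rw [← union_iUnion, eq_comm, union_eq_right]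
      intro x hx
      obtain ⟨i, hi⟩ := hKA x hx
      exact mem_iUnion.2 ⟨i, subset_closure hi⟩
    rw [this]
    refine isPreconnected_iUnion ⟨x₀, mem_iInter.2 fun i => Or.inl hx₀⟩ fun i => ?_
    exact (hKc.union ⟨p i, hpK i, subset_closure (hpA i)⟩ (hA _ (hAm i)).1.closure).isPreconnected
  · exact fun i j => hIC _ (hAm i) _ (hAm j)
  · intro x
    by_cases hx : ∃ i, x ∈ A i
    · obtain ⟨i, hi⟩ := hx
      have : pwConst m A (fun i => f (p i)) x = f (p i) := by
        unfold pwConst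
        rw [Finset.sum_eq_single i]
        · exact indicator_of_mem hi _
        · intro j _ hj
          exact indicator_of_notMem (fun h => disjoint_left.1 (hAd hj) h hi) _
        · simp
      rw [this, ← Real.dist_eq]
      exact (hδf (hdist _ (hAm i) x hi _ (hpA i))).le
    · have : pwConst m A (fun i => f (p i)) x = 0 := by
        unfold pwConst
        refine Finset.sum_eq_zero fun i _ => ?_
        exact indicator_of_notMem (fun h => hx ⟨i, h⟩) _
      rw [this, sub_zero, abs_of_nonneg (hf_nonneg x)]
      have h2 : ¬ l ≤ f x := fun h => hx (hKA x h)
      exact (not_le.1 h2).le.trans (min_le_left _ _)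

/-- Suppose `(Ω, d)` is a metric space in which all closed and bounded sets are compact
and which has the internally connected partition property. If `f : Ω → [0, ∞)` is
continuous, with all upper level sets bounded, and with connected upper `λ`-level sets
for all small enough `λ > 0`, then for every `η > 0` there is `g ∈ F_int` with
`‖f − g‖_∞ ≤ η`; in particular, some sequence in `F_int` converges uniformly to `f`. -/
theorem exists_Fint_uniform_approx {Ω : Type*} [MetricSpace Ω] [LocallyConnectedSpace Ω]
    (hHB : ∀ s : Set Ω, IsClosed s → IsBounded s → IsCompact s)
    (hICPP : HasICPartitionProperty Ω)
    (f : Ω → ℝ) (hf_cont : Continuous f) (hf_nonneg : ∀ x, 0 ≤ f x)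
    (hf_bdd : ∀ lam : ℝ, 0 < lam → IsBounded {x | lam ≤ f x})
    (hf_conn : ∃ lam₀ > (0 : ℝ), ∀ lam : ℝ, 0 < lam → lam ≤ lam₀ →
      IsConnected {x | lam ≤ f x}) :
    (∀ η : ℝ, 0 < η → ∃ g : Ω → ℝ, MemFint g ∧ ∀ x, |f x - g x| ≤ η) ∧
    ∃ fn : ℕ → Ω → ℝ, (∀ n, MemFint (fn n)) ∧
      TendstoUniformly fn f Filter.atTop := by
  have key := aux_approx hHB hICPP f hf_cont hf_nonneg hf_bdd hf_conn
  refine ⟨key, ?_⟩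
  choose g hg hgf using fun n : ℕ => key (1 / ((n : ℝ) + 1)) Nat.one_div_pos_of_nat
  refine ⟨g, hg, ?_⟩
  rw [Metric.tendstoUniformly_iff]
  intro ε hε
  have := (tendsto_one_div_add_atTop_nhds_zero_nat (𝕜 := ℝ)).eventually (gt_mem_nhds hε)
  filter_upwards [this] with n hn x
  rw [Real.dist_eq]
  exact (hgf n x).trans_lt hn
end

section
/- Let (Ω, d) be a metric space in which all closed and bounded sets are compact, and let f : Ω → [0, ∞) be continuous with all upper level sets bounded. If an upper level set U = {f ≥ λ}, λ > 0, contains only finitely many modes of f, then U has at most as many connected components as the number of modes it contains; in particular, U has finitely many connected components. -/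
open Set Topology Bornology

/-- `C` is a connected component of the set `s` (a maximal connected subset). -/
def IsConnCompOf {Ω : Type*} [TopologicalSpace Ω] (s C : Set Ω) : Prop :=
  ∃ x ∈ s, C = connectedComponentIn s x

/-- A mode of `f` is a local maximum with strictly positive value: a point `x` with
`f x > 0` such that `f x ≥ f y` whenever `d(x, y) ≤ r`, for some `r > 0`. -/
def IsMode {Ω : Type*} [MetricSpace Ω] (f : Ω → ℝ) (x : Ω) : Prop :=
  0 < f x ∧ ∃ r > (0 : ℝ), ∀ y, dist x y ≤ r → f y ≤ f x

/-- In a metric space where all closed and bounded sets are compact, let `f : Ω → [0,∞)`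
be continuous with all upper level sets bounded.  If the upper level set
`U = {f ≥ lam}`, `lam > 0`, contains only finitely many modes of `f`, then `U` has at
most as many connected components as it contains modes; in particular it has finitely
many connected components. -/
theorem card_components_le_card_modes {Ω : Type*} [MetricSpace Ω]
    (hHB : ∀ s : Set Ω, IsClosed s → IsBounded s → IsCompact s)
    (f : Ω → ℝ) (hf_cont : Continuous f) (hf_nonneg : ∀ x, 0 ≤ f x)
    (hf_bdd : ∀ t : ℝ, 0 < t → IsBounded {x | t ≤ f x})
    (lam : ℝ) (hlam : 0 < lam)
    (hmodes : {x ∈ {y | lam ≤ f y} | IsMode f x}.Finite) :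
    {C : Set Ω | IsConnCompOf {y | lam ≤ f y} C}.Finite ∧
    {C : Set Ω | IsConnCompOf {y | lam ≤ f y} C}.ncard
      ≤ {x ∈ {y | lam ≤ f y} | IsMode f x}.ncard := by
  set U : Set Ω := {y | lam ≤ f y} with hU
  have hUc : IsCompact U := hHB U (isClosed_le continuous_const hf_cont) (hf_bdd lam hlam)
  haveI : CompactSpace U := isCompact_iff_compactSpace.mp hUc
  have clop : ∀ K : Set U, IsClopen K → K.Nonempty → ∃ m ∈ K, IsMode f (m : Ω) := by
    intro K hK hne
    obtain ⟨m, hmK, hmax⟩ := hK.isClosed.isCompact.exists_isMaxOn hne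
      (hf_cont.comp continuous_subtype_val).continuousOn
    refine ⟨m, hmK, lt_of_lt_of_le hlam m.2, ?_⟩
    obtain ⟨e, he, hball⟩ := Metric.isOpen_iff.mp hK.isOpen m hmK
    refine ⟨e / 2, half_pos he, fun y hy => ?_⟩
    by_cases hyU : y ∈ U
    · have h1 : (⟨y, hyU⟩ : U) ∈ K := by
        apply hball
        rw [Metric.mem_ball, dist_comm, Subtype.dist_eq]
        change dist (m : Ω) y < e
        linarith
      exact hmax h1
    · have h2 : f y < lam := not_le.mp hyU
      have h3 : lam ≤ f m := m.2
      linarith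
  have key : ∀ x : U, ∃ m : U, IsMode f (m : Ω) ∧ m ∈ connectedComponent x := by
    intro x
    by_contra hcon
    push Not at hcon
    have hfin : {m : U | IsMode f (m : Ω)}.Finite := by
      refine Set.Finite.of_finite_image (f := Subtype.val) (hmodes.subset ?_)
        Subtype.val_injective.injOn
      rintro _ ⟨m, hm, rfl⟩
      exact ⟨m.2, hm⟩
    have hZ : ∀ m : U, ∃ Z : Set U, IsClopen Z ∧ x ∈ Z ∧ (IsMode f (m : Ω) → m ∉ Z) := by
      intro m
      by_cases hm : IsMode f (m : Ω)
      · have h := hcon m hm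
        rw [connectedComponent_eq_iInter_isClopen, Set.mem_iInter] at h
        push Not at h
        obtain ⟨⟨Z, hZ1, hZ2⟩, hZ3⟩ := h
        exact ⟨Z, hZ1, hZ2, fun _ => hZ3⟩
      · exact ⟨univ, isClopen_univ, mem_univ _, fun h => absurd h hm⟩
    choose Z hZ1 hZ2 hZ3 using hZ
    obtain ⟨m, hmK, hm⟩ := clop (⋂ m ∈ {m : U | IsMode f (m : Ω)}, Z m)
      (hfin.isClopen_biInter fun m _ => hZ1 m) ⟨x, mem_iInter₂.mpr fun m _ => hZ2 m⟩
    exact hZ3 m hm (mem_iInter₂.mp hmK m hm)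
  have hsub : {C : Set Ω | IsConnCompOf U C} ⊆
      (fun x => connectedComponentIn U x) '' {x ∈ U | IsMode f x} := by
    rintro C ⟨x, hx, rfl⟩
    obtain ⟨m, hm, hmx⟩ := key ⟨x, hx⟩
    refine ⟨m, ⟨m.2, hm⟩, ?_⟩
    refine (connectedComponentIn_eq ?_).symm
    rw [connectedComponentIn_eq_image hx]
    exact ⟨m, hmx, rfl⟩
  exact ⟨(hmodes.image _).subset hsub,
    (Set.ncard_le_ncard hsub (hmodes.image _)).trans (Set.ncard_image_le hmodes)⟩
end

section
/- Let (Ω, d) be a locally connected metric space in which all closed and bounded sets are compact, and let f : Ω → [0, ∞) be continuous with all upper level sets bounded and with locally finitely many modes (every bounded subset of Ω contains only finitely many modes of f). Then f satisfies the splitting property: for every λ > 0, for all sufficiently small ε > 0, each connected component of {x : f(x) > λ} contains exactly one connected component of {x : f(x) > λ + ε}. -/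
open Set Topology Bornology

theorem sp_mono {Ω : Type*} [TopologicalSpace Ω] (f : Ω → ℝ) {s t : ℝ} (h : s ≤ t) (x : Ω) :
    connectedComponentIn {x | t < f x} x ⊆ connectedComponentIn {x | s < f x} x :=
  connectedComponentIn_mono x (fun _ hy => lt_of_le_of_lt h hy)

theorem sp_join {Ω : Type*} [TopologicalSpace Ω] [LocallyConnectedSpace Ω] (f : Ω → ℝ)
    (hf : Continuous f) (lam : ℝ) (m m' : Ω)
    (h : m' ∈ connectedComponentIn {x | lam < f x} m) :
    ∃ e > (0 : ℝ), m' ∈ connectedComponentIn {x | lam + e < f x} m := by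
  have hop : ∀ t : ℝ, IsOpen {x | t < f x} := fun t => isOpen_lt continuous_const hf
  have hm : lam < f m := by
    by_contra hc
    rw [connectedComponentIn_eq_empty (F := {x | lam < f x}) hc] at h
    exact h
  let W : Set Ω := {y | ∃ e > (0 : ℝ), y ∈ connectedComponentIn {x | lam + e < f x} m}
  have hself : ∀ z, lam < f z →
      z ∈ connectedComponentIn {x | lam + (f z - lam) / 2 < f x} z := by
    intro z hz
    apply mem_connectedComponentIn
    show lam + (f z - lam) / 2 < f z
    linarith
  have hWo : IsOpen W := by
    have : W = ⋃ e > (0 : ℝ), connectedComponentIn {x | lam + e < f x} m := by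
      ext y; simp [W]
    rw [this]
    exact isOpen_iUnion fun e => isOpen_iUnion fun _ => (hop _).connectedComponentIn
  have hmW : m ∈ W := ⟨(f m - lam) / 2, by linarith, hself m hm⟩
  have hsub : connectedComponentIn {x | lam < f x} m ⊆ W := by
    apply isPreconnected_connectedComponentIn.subset_of_closure_inter_subset hWo
    · exact ⟨m, mem_connectedComponentIn hm, hmW⟩
    · rintro z ⟨hzc, hzR⟩
      have hz : lam < f z := connectedComponentIn_subset {x | lam < f x} _ hzR
      obtain ⟨y, hyz, e, he, hym⟩ := mem_closure_iff.1 hzc _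
        (hop (lam + (f z - lam) / 2)).connectedComponentIn (hself z hz)
      refine ⟨min e ((f z - lam) / 2), lt_min he (by linarith), ?_⟩
      have h1 := sp_mono f (add_le_add_right (min_le_left e ((f z - lam) / 2)) lam) m hym
      have h2 := sp_mono f (add_le_add_right (min_le_right e ((f z - lam) / 2)) lam) z hyz
      rw [connectedComponentIn_eq h1, ← connectedComponentIn_eq h2]
      apply mem_connectedComponentIn
      exact lt_of_le_of_lt (add_le_add_right (min_le_right e ((f z - lam) / 2)) lam)
        (connectedComponentIn_subset {x | lam + (f z - lam) / 2 < f x} _ (hself z hz))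
  exact hsub h

theorem sp_mode {Ω : Type*} [MetricSpace Ω] [LocallyConnectedSpace Ω]
    (hHB : ∀ s : Set Ω, IsClosed s → IsBounded s → IsCompact s)
    (f : Ω → ℝ) (hf_cont : Continuous f)
    (hf_bdd : ∀ t : ℝ, 0 < t → IsBounded {x | t ≤ f x}) (t : ℝ) (ht : 0 < t) (x : Ω)
    (hx : t < f x) : ∃ m ∈ connectedComponentIn {x | t < f x} x, IsMode f m := by
  have hop : IsOpen {x | t < f x} := isOpen_lt continuous_const hf_cont
  have hxR : x ∈ connectedComponentIn {x | t < f x} x := mem_connectedComponentIn hx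
  have hb : IsBounded (connectedComponentIn {x | t < f x} x) :=
    (hf_bdd t ht).subset fun y hy => le_of_lt (a := t) (b := f y)
      (connectedComponentIn_subset {x | t < f x} _ hy)
  obtain ⟨m, hm, hmax⟩ := (hHB _ isClosed_closure hb.closure).exists_isMaxOn
    ⟨x, subset_closure hxR⟩ hf_cont.continuousOn
  have hfm : t < f m := lt_of_lt_of_le hx (hmax (subset_closure hxR))
  obtain ⟨y, hym, hyx⟩ := mem_closure_iff.1 hm _ (hop.connectedComponentIn (x := m))
    (mem_connectedComponentIn hfm)
  have hmR : m ∈ connectedComponentIn {x | t < f x} x := by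
    rw [connectedComponentIn_eq hyx, ← connectedComponentIn_eq hym]
    exact mem_connectedComponentIn hfm
  refine ⟨m, hmR, ht.trans hfm, ?_⟩
  obtain ⟨r, hr, hball⟩ := Metric.isOpen_iff.1 (hop.connectedComponentIn (x := x)) m hmR
  refine ⟨r / 2, by positivity, fun y hy => hmax (subset_closure (hball ?_))⟩
  rw [Metric.mem_ball, dist_comm]
  linarith

/-- Let `(Ω, d)` be a locally connected metric space in which all closed and bounded
sets are compact, and let `f : Ω → [0,∞)` be continuous, with all upper level sets
bounded, and with locally finitely many modes (every bounded set contains finitely many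
modes).  Then `f` satisfies the splitting property: for every `lam > 0` and all small
enough `ε > 0`, each connected component of `{f > lam}` contains exactly one connected
component of `{f > lam + ε}`. -/
theorem splitting_property_of_locally_finitely_many_modes {Ω : Type*} [MetricSpace Ω]
    [LocallyConnectedSpace Ω]
    (hHB : ∀ s : Set Ω, IsClosed s → IsBounded s → IsCompact s)
    (f : Ω → ℝ) (hf_cont : Continuous f) (hf_nonneg : ∀ x, 0 ≤ f x)
    (hf_bdd : ∀ t : ℝ, 0 < t → IsBounded {x | t ≤ f x})
    (hf_modes : ∀ B : Set Ω, IsBounded B → {x ∈ B | IsMode f x}.Finite) :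
    ∀ lam : ℝ, 0 < lam → ∃ ε₀ > (0 : ℝ), ∀ ε : ℝ, 0 < ε → ε ≤ ε₀ →
      ∀ R : Set Ω, IsConnCompOf {x | lam < f x} R →
        ∃! V : Set Ω, IsConnCompOf {x | lam + ε < f x} V ∧ V ⊆ R := by
  intro lam hlam
  have hfin : {x ∈ {x | lam ≤ f x} | IsMode f x}.Finite := hf_modes _ (hf_bdd lam hlam)
  set M := {x ∈ {x | lam ≤ f x} | IsMode f x} with hM
  have hev : ∀ᶠ e in 𝓝[>] (0 : ℝ), ∀ m ∈ M, ∀ m' ∈ M,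
      m' ∈ connectedComponentIn {x | lam < f x} m →
      m' ∈ connectedComponentIn {x | lam + e < f x} m := by
    rw [Filter.eventually_all_finite hfin]
    intro m _
    rw [Filter.eventually_all_finite hfin]
    intro m' _
    by_cases h : m' ∈ connectedComponentIn {x | lam < f x} m
    · obtain ⟨e, he, hme⟩ := sp_join f hf_cont lam m m' h
      filter_upwards [Ioc_mem_nhdsGT he] with e' he' _
      exact sp_mono f (add_le_add_right he'.2 lam) m hme
    · exact Filter.Eventually.of_forall fun _ h' => absurd h' h
  obtain ⟨ε₀, hε₀, hsub⟩ := mem_nhdsGT_iff_exists_Ioc_subset.1 hev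
  refine ⟨ε₀, hε₀, fun ε hε hεl => ?_⟩
  have key := hsub ⟨hε, hεl⟩
  rintro R ⟨x, hx, rfl⟩
  have hmono : ∀ y, connectedComponentIn {x | lam + ε < f x} y ⊆
      connectedComponentIn {x | lam < f x} y := sp_mono f (by linarith)
  have hMem : ∀ y z, z ∈ connectedComponentIn {x | lam < f x} y → IsMode f z → z ∈ M :=
    fun y z hz hm => ⟨le_of_lt (a := lam) (b := f z)
      (connectedComponentIn_subset {x | lam < f x} _ hz), hm⟩
  obtain ⟨m, hmR, hm⟩ := sp_mode hHB f hf_cont hf_bdd lam hlam x hx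
  have hmM := hMem _ _ hmR hm
  have hmε := key m hmM m hmM (mem_connectedComponentIn (connectedComponentIn_subset _ _ hmR))
  refine ⟨connectedComponentIn {x | lam + ε < f x} m,
    ⟨⟨m, connectedComponentIn_subset _ _ hmε, rfl⟩, ?_⟩, ?_⟩
  · rw [connectedComponentIn_eq hmR]
    exact hmono m
  · rintro V ⟨⟨y, hy, rfl⟩, hV⟩
    obtain ⟨m', hm'V, hm'⟩ := sp_mode hHB f hf_cont hf_bdd (lam + ε) (by linarith) y hy
    have hm'R := hV hm'V
    have hm'M := hMem _ _ hm'R hm'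
    rw [connectedComponentIn_eq hmR] at hm'R
    rw [connectedComponentIn_eq (key m hmM m' hm'M hm'R), connectedComponentIn_eq hm'V]
end

section
/- For every d ≥ 1, the Euclidean space ℝ^d (with the Euclidean metric) has the internally connected partition property: for every r > 0 there exists a locally finite partition {A_i} of ℝ^d having the internally connected property, with each A_i connected, having connected interior, and of diameter at most r. -/
open Set Topology

/-- shear -/
noncomputable def icV {d : ℕ} (α : ℝ) (n : Fin d → ℤ) (i : Fin d) : ℝ :=
  n i + ∑ j ∈ Finset.Iio i, α ^ (j.val + 1) * n j

/-- half-open box -/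
def icA {d : ℕ} (s : ℝ) (v : Fin d → ℝ) : Set (EuclideanSpace ℝ (Fin d)) :=
  {x | ∀ i, s * v i ≤ x i ∧ x i < s * v i + s}

/-- closed box -/
def icQ {d : ℕ} (s : ℝ) (v : Fin d → ℝ) : Set (EuclideanSpace ℝ (Fin d)) :=
  {x | ∀ i, s * v i ≤ x i ∧ x i ≤ s * v i + s}

lemma icV_sub {d : ℕ} (α : ℝ) (n m : Fin d → ℤ) (i : Fin d) :
    icV α (n - m) i = icV α n i - icV α m i := by
  simp only [icV, Pi.sub_apply, Int.cast_sub, mul_sub, Finset.sum_sub_distrib]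
  ring

lemma icV_int {d : ℕ} {α : ℝ} (hα : Transcendental ℤ α) (n : Fin d → ℤ) (i : Fin d) (z : ℤ)
    (h : icV α n i = z) : ∀ j < i, n j = 0 := by
  intro j hj
  let p : Polynomial ℤ := ∑ j ∈ Finset.Iio i, Polynomial.monomial (j.val + 1) (n j)
    + Polynomial.C (n i - z)
  have hp : Polynomial.aeval α p = 0 := by
    simp only [p, map_add, map_sum, Polynomial.aeval_monomial, Polynomial.aeval_C]
    simp only [icV] at h
    simp only [algebraMap_int_eq, eq_intCast, Int.cast_sub]
    have : ∑ j ∈ Finset.Iio i, (n j : ℝ) * α ^ (j.val + 1)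
      = ∑ j ∈ Finset.Iio i, α ^ (j.val + 1) * n j :=
      Finset.sum_congr rfl fun _ _ => mul_comm _ _
    rw [this]; linarith
  have hp0 : p = 0 := by
    by_contra hne
    exact hα ⟨p, hne, hp⟩
  have hc : p.coeff (j.val + 1) = n j := by
    simp only [p, Polynomial.coeff_add, Polynomial.finsetSum_coeff, Polynomial.coeff_monomial,
      Polynomial.coeff_C]
    rw [Finset.sum_eq_single j]
    · simp
    · intro b _ hb
      have : b.val ≠ j.val := fun h => hb (Fin.ext h)
      simp [this]
    · intro h; simp at h; omega
  rw [← hc, hp0]; simp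

lemma icV_min {d : ℕ} (α : ℝ) (n : Fin d → ℤ) (hn : n ≠ 0) :
    ∃ k, n k ≠ 0 ∧ icV α n k = n k := by
  classical
  have hne : (Finset.univ.filter fun k => n k ≠ 0).Nonempty := by
    obtain ⟨k, hk⟩ := Function.ne_iff.1 hn
    exact ⟨k, by simpa using hk⟩
  obtain ⟨k, hk⟩ := Finset.exists_minimal hne
  refine ⟨k, by simpa using hk.1, ?_⟩
  simp only [icV]
  rw [Finset.sum_eq_zero, add_zero]
  intro j hj
  have hj' : j < k := by simpa using hj
  by_cases h : n j = 0
  · simp [h]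
  · exact absurd (hk.2 (y := j) (by simpa using h) hj'.le) (not_le.2 hj')

lemma icV_exists {d : ℕ} (α : ℝ) (y : Fin d → ℝ) :
    ∃ n : Fin d → ℤ, ∀ i, icV α n i ≤ y i ∧ y i < icV α n i + 1 := by
  have key : ∀ k ≤ d, ∃ n : Fin d → ℤ, ∀ i : Fin d, i.val < k →
      icV α n i ≤ y i ∧ y i < icV α n i + 1 := by
    intro k
    induction k with
    | zero => intro _; exact ⟨0, fun i hi => absurd hi (by omega)⟩
    | succ k ih =>
      intro hk
      obtain ⟨n, hn⟩ := ih (by omega)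
      let K : Fin d := ⟨k, by omega⟩
      let S := ∑ j ∈ Finset.Iio K, α ^ (j.val + 1) * (n j : ℝ)
      refine ⟨Function.update n K ⌊y K - S⌋, ?_⟩
      have hsum : ∀ i : Fin d, i ≤ K → ∑ j ∈ Finset.Iio i, α ^ (j.val + 1) *
          ((Function.update n K ⌊y K - S⌋ j : ℤ) : ℝ)
          = ∑ j ∈ Finset.Iio i, α ^ (j.val + 1) * (n j : ℝ) := by
        intro i hi
        refine Finset.sum_congr rfl fun j hj => ?_
        have : j ≠ K := by
          have := Finset.mem_Iio.1 hj
          exact (this.trans_le hi).ne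
        rw [Function.update_of_ne this]
      intro i hi
      rcases Nat.lt_succ_iff_lt_or_eq.1 hi with h | h
      · have hiK : i < K := h
        have := hn i h
        simp only [icV] at this ⊢
        rw [hsum i hiK.le, Function.update_of_ne hiK.ne]
        exact this
      · have hiK : i = K := Fin.ext h
        subst hiK
        simp only [icV]
        rw [hsum _ le_rfl, Function.update_self]
        have h1 := Int.floor_le (y K - S)
        have h2 := Int.lt_floor_add_one (y K - S)
        constructor <;> linarith
  obtain ⟨n, hn⟩ := key d le_rfl
  exact ⟨n, fun i => hn i i.2⟩

lemma icV_finite {d : ℕ} (α : ℝ) (y : Fin d → ℝ) (C : ℝ) :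
    {n : Fin d → ℤ | ∀ i, |icV α n i - y i| ≤ C}.Finite := by
  have key : ∀ i : Fin d, ∃ B : ℝ, ∀ n : Fin d → ℤ, (∀ i, |icV α n i - y i| ≤ C) →
      |(n i : ℝ)| ≤ B := by
    intro i
    induction i using WellFoundedLT.induction with
    | ind i ih =>
      have : ∀ j : Fin d, ∃ B : ℝ, j < i → ∀ n : Fin d → ℤ, (∀ i, |icV α n i - y i| ≤ C) →
          |(n j : ℝ)| ≤ B := by
        intro j
        by_cases h : j < i
        · obtain ⟨B, hB⟩ := ih j h
          exact ⟨B, fun _ => hB⟩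
        · exact ⟨0, fun h' => absurd h' h⟩
      choose B hB using this
      refine ⟨C + |y i| + ∑ j ∈ Finset.Iio i, |α ^ (j.val + 1)| * B j, fun n hn => ?_⟩
      have h1 : |∑ j ∈ Finset.Iio i, α ^ (j.val + 1) * (n j : ℝ)|
          ≤ ∑ j ∈ Finset.Iio i, |α ^ (j.val + 1)| * B j := by
        refine (Finset.abs_sum_le_sum_abs _ _).trans (Finset.sum_le_sum fun j hj => ?_)
        rw [abs_mul]
        exact mul_le_mul_of_nonneg_left (hB j (Finset.mem_Iio.1 hj) n hn) (abs_nonneg _)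
      have h2 := hn i
      simp only [icV] at h2
      rw [abs_le] at h1 h2 ⊢
      have h3 := neg_abs_le (y i)
      have h4 := le_abs_self (y i)
      constructor <;> linarith
  choose B hB using key
  refine (Set.finite_Icc (fun i => -⌈B i⌉) (fun i => ⌈B i⌉)).subset fun n hn => ?_
  have h : ∀ i, |(n i : ℝ)| ≤ ⌈B i⌉ := fun i => (hB i n hn).trans (Int.le_ceil _)
  have h' : ∀ i, |n i| ≤ ⌈B i⌉ := fun i => by exact_mod_cast h i
  exact ⟨fun i => (abs_le.1 (h' i)).1, fun i => (abs_le.1 (h' i)).2⟩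

lemma icA_eq {d : ℕ} (s : ℝ) (v : Fin d → ℝ) :
    icA s v = (EuclideanSpace.equiv (Fin d) ℝ).toHomeomorph ⁻¹'
      (Set.pi univ fun i => Ico (s * v i) (s * v i + s)) := by
  ext x; simp [icA, Set.mem_pi]

lemma icQ_eq {d : ℕ} (s : ℝ) (v : Fin d → ℝ) :
    icQ s v = (EuclideanSpace.equiv (Fin d) ℝ).toHomeomorph ⁻¹'
      (Set.pi univ fun i => Icc (s * v i) (s * v i + s)) := by
  ext x
  exact ⟨fun h i _ => h i, fun h i => h i (mem_univ i)⟩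

lemma icA_closure {d : ℕ} {s : ℝ} (hs : 0 < s) (v : Fin d → ℝ) :
    closure (icA s v) = icQ s v := by
  rw [icA_eq, icQ_eq, ← Homeomorph.preimage_closure, closure_pi_set]
  congr 2
  funext i
  exact closure_Ico (by linarith)

lemma icA_interior {d : ℕ} {s : ℝ} (hs : 0 < s) (v : Fin d → ℝ) :
    (interior (icA s v)).Nonempty := by
  rw [icA_eq, ← Homeomorph.preimage_interior, interior_pi_set finite_univ]
  refine ⟨WithLp.toLp 2 fun i => s * v i + s / 2, ?_⟩
  simp only [interior_Ico]
  intro i _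
  simp
  exact hs

lemma icA_convex {d : ℕ} (s : ℝ) (v : Fin d → ℝ) : Convex ℝ (icA s v) := by
  have := (convex_pi (𝕜 := ℝ) (s := univ) (t := fun i => Ico (s * v i) (s * v i + s))
    fun i _ => convex_Ico _ _).linear_preimage
      (EuclideanSpace.equiv (Fin d) ℝ).toLinearEquiv.toLinearMap
  rw [icA_eq]
  exact this

lemma ic_union {E : Type*} [NormedAddCommGroup E] [NormedSpace ℝ E] {P Q : Set E}
    (hP : Convex ℝ P) (hQ : Convex ℝ Q)
    (hP' : (interior P).Nonempty) (hQ' : (interior Q).Nonempty) {p : E}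
    (h1 : p ∈ closure P) (h2 : p ∈ closure Q) (h : p ∈ interior (closure P ∪ closure Q)) :
    IsConnected (interior (closure P ∪ closure Q)) := by
  have eP := hP.closure_interior_eq_closure_of_nonempty_interior hP'
  have eQ := hQ.closure_interior_eq_closure_of_nonempty_interior hQ'
  have cP : IsConnected (insert p (interior P)) :=
    (hP.interior.isConnected hP').subset_closure (subset_insert _ _)
      (insert_subset (eP ▸ h1) subset_closure)
  have cQ : IsConnected (insert p (interior Q)) :=
    (hQ.interior.isConnected hQ').subset_closure (subset_insert _ _)
      (insert_subset (eQ ▸ h2) subset_closure)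
  have c := cP.union ⟨p, mem_insert _ _, mem_insert _ _⟩ cQ
  refine c.subset_closure ?_ ?_
  · refine union_subset (insert_subset h ?_) (insert_subset h ?_)
    · exact interior_mono (subset_closure.trans subset_union_left)
    · exact interior_mono (subset_closure.trans subset_union_right)
  · rw [closure_union]
    refine interior_subset.trans (union_subset_union ?_ ?_)
    · rw [← eP]; exact closure_mono (subset_insert _ _)
    · rw [← eQ]; exact closure_mono (subset_insert _ _)

lemma ic_mid {d : ℕ} {s : ℝ} (hs : 0 < s) (v w : Fin d → ℝ) (k : Fin d)
    (hk : w k = v k + 1) (hi : ∀ i, i ≠ k → |w i - v i| < 1) :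
    ∃ p, p ∈ icQ s v ∧ p ∈ icQ s w ∧ p ∈ interior (icQ s v ∪ icQ s w) := by
  let p : EuclideanSpace ℝ (Fin d) := WithLp.toLp 2 fun i => s * ((v i + w i + 1) / 2)
  have hp : ∀ i, p i = s * ((v i + w i + 1) / 2) := fun i => rfl
  have hle : ∀ i, |w i - v i| ≤ 1 := by
    intro i
    by_cases h : i = k
    · subst h; rw [hk]; simp
    · exact (hi i h).le
  refine ⟨p, ?_, ?_, ?_⟩
  · intro i
    have := abs_le.1 (hle i)
    rw [hp]
    constructor <;> nlinarith
  · intro i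
    have := abs_le.1 (hle i)
    rw [hp]
    constructor <;> nlinarith
  · rw [mem_interior]
    let δ : Fin d → ℝ := fun i => if i = k then s else s * ((1 - |w i - v i|) / 2)
    have hδ : ∀ i, 0 < δ i := by
      intro i
      by_cases h : i = k
      · simp [δ, h, hs]
      · simp only [δ, h, if_false]
        have := hi i h
        apply mul_pos hs; linarith
    refine ⟨⋂ i, {x : EuclideanSpace ℝ (Fin d) | |x i - p i| < δ i}, ?_, ?_, ?_⟩
    · intro x hx
      have hx' : ∀ i, |x i - p i| < δ i := by simpa using hx
      have hk' := hx' k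
      simp only [δ, if_true, hp, hk] at hk'
      rw [abs_lt] at hk'
      have hoth : ∀ i, i ≠ k → (s * v i ≤ x i ∧ x i ≤ s * v i + s) ∧
          (s * w i ≤ x i ∧ x i ≤ s * w i + s) := by
        intro i h
        have h1 := hx' i
        simp only [δ, h, if_false, hp] at h1
        rw [abs_lt] at h1
        have h2 := mul_le_mul_of_nonneg_left (le_abs_self (w i - v i)) hs.le
        have h3 := mul_le_mul_of_nonneg_left (neg_abs_le (w i - v i)) hs.le
        refine ⟨⟨?_, ?_⟩, ?_, ?_⟩ <;> nlinarith
      by_cases hc : x k ≤ s * v k + s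
      · left
        intro i
        by_cases h : i = k
        · subst h
          exact ⟨by nlinarith, hc⟩
        · exact (hoth i h).1
      · right
        intro i
        by_cases h : i = k
        · subst h
          rw [hk]
          constructor <;> nlinarith
        · exact (hoth i h).2
    · refine isOpen_iInter_of_finite fun i => ?_
      exact isOpen_lt (by fun_prop) continuous_const
    · simp only [mem_iInter, mem_ofPred_eq, sub_self, abs_zero]
      exact hδ

/-- Every Euclidean space `ℝ^d`, `d ≥ 1`, has the internally connected partition
property. -/
theorem euclidean_has_icpp (d : ℕ) (hd : 1 ≤ d) :
    HasICPartitionProperty (EuclideanSpace ℝ (Fin d)) := by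
  obtain ⟨α, hα⟩ : ∃ α : ℝ, Transcendental ℤ α :=
    ⟨_, transcendental_liouvilleNumber (m := 2) le_rfl⟩
  refine ⟨isConnected_univ, fun r hr => ?_⟩
  have hd0 : (0 : ℝ) < d := by exact_mod_cast hd
  obtain ⟨s, hs, hsr⟩ : ∃ s : ℝ, 0 < s ∧ d * s = r := ⟨r / d, by positivity, by field_simp⟩
  have hdist : ∀ n : Fin d → ℤ, ∀ i, ∀ x ∈ icA s (icV α n), ∀ y ∈ icA s (icV α n),
      |x i - y i| ≤ s := by
    intro n i x hx y hy
    have h1 := hx i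
    have h2 := hy i
    rw [abs_le]; constructor <;> linarith
  refine ⟨range fun n : Fin d → ℤ => icA s (icV α n), ?_, ?_, ?_, ?_, ?_⟩
  · rintro _ ⟨n, rfl⟩
    have hne := icA_interior hs (icV α n)
    have hc := icA_convex s (icV α n)
    refine ⟨hc.isConnected (hne.mono interior_subset), hc.interior.isConnected hne, ?_⟩
    refine EMetric.diam_le fun x hx y hy => ?_
    rw [edist_dist]
    refine ENNReal.ofReal_le_ofReal ?_
    rw [EuclideanSpace.dist_eq, ← hsr]
    refine Real.sqrt_le_iff.2 ⟨by positivity, ?_⟩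
    have : ∑ i, dist (x i) (y i) ^ 2 ≤ ∑ _i : Fin d, s ^ 2 := by
      refine Finset.sum_le_sum fun i _ => ?_
      rw [Real.dist_eq]
      exact pow_le_pow_left₀ (abs_nonneg _) (hdist n i x hx y hy) 2
    refine this.trans ?_
    simp only [Finset.sum_const, Finset.card_univ, Fintype.card_fin, nsmul_eq_mul]
    have h1 : (1 : ℝ) ≤ d := by exact_mod_cast hd
    have : 0 < s ^ 2 := by positivity
    nlinarith [mul_pos hd0 this]
  · rintro _ ⟨n, rfl⟩ _ ⟨m, rfl⟩ hne
    rw [Set.disjoint_left]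
    intro x hx hy
    have hnm : n - m ≠ 0 := fun h => hne (by rw [sub_eq_zero.1 h])
    obtain ⟨k, hk, hk'⟩ := icV_min α _ hnm
    rw [icV_sub] at hk'
    have h1 := hx k
    have h2 := hy k
    have h3 : icV α n k - icV α m k < 1 := by nlinarith
    have h4 : -1 < icV α n k - icV α m k := by nlinarith
    rw [hk'] at h3 h4
    have h3' : (n - m) k < 1 := by exact_mod_cast h3
    have h4' : -1 < (n - m) k := by exact_mod_cast h4
    omega
  · refine eq_univ_of_forall fun x => ?_
    obtain ⟨n, hn⟩ := icV_exists α fun i => x i / s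
    refine ⟨_, ⟨n, rfl⟩, fun i => ?_⟩
    obtain ⟨h1, h2⟩ := hn i
    rw [le_div_iff₀ hs] at h1
    rw [div_lt_iff₀ hs] at h2
    constructor <;> linarith
  · intro x
    refine ⟨Metric.ball x s, Metric.ball_mem_nhds x hs, ?_⟩
    refine ((icV_finite α (fun i => x i / s) 2).image fun n => icA s (icV α n)).subset ?_
    rintro _ ⟨⟨n, rfl⟩, y, hy, hyx⟩
    refine ⟨n, fun i => ?_, rfl⟩
    have h1 := hy i
    have h2 : |y i - x i| < s := by
      rw [Metric.mem_ball, dist_eq_norm] at hyx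
      exact (PiLp.norm_apply_le (y - x) i).trans_lt hyx
    rw [abs_lt] at h2
    have h3 : x i = s * (x i / s) := by field_simp
    generalize x i / s = t at h3 ⊢
    rw [abs_le]
    constructor <;> nlinarith
  · rintro _ ⟨n, rfl⟩ _ ⟨m, rfl⟩ hconn
    have hA := icA_convex s (icV α n)
    have hB := icA_convex s (icV α m)
    have iA := icA_interior hs (icV α n)
    have iB := icA_interior hs (icV α m)
    by_cases hnm : n = m
    · subst hnm
      simp only [union_self]
      exact hA.closure.interior.isConnected (iA.mono (interior_mono subset_closure))
    obtain ⟨q, -, hq1, hq2⟩ := isPreconnected_closed_iff.1 hconn.2 _ _ isClosed_closure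
      isClosed_closure Subset.rfl
      ((iA.mono (interior_subset.trans subset_closure)).mono
        (subset_inter subset_union_left Subset.rfl))
      ((iB.mono (interior_subset.trans subset_closure)).mono
        (subset_inter subset_union_right Subset.rfl))
    rw [icA_closure hs] at hq1 hq2
    have hle : ∀ i, |icV α m i - icV α n i| ≤ 1 := by
      intro i
      have h1 := hq1 i
      have h2 := hq2 i
      rw [abs_le]
      constructor <;> nlinarith
    have hmn : m - n ≠ 0 := fun h => hnm (sub_eq_zero.1 h).symm
    obtain ⟨k, hk, hk'⟩ := icV_min α _ hmn
    have hkabs : (m - n) k = 1 ∨ (m - n) k = -1 := by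
      have := hle k
      rw [← icV_sub, hk'] at this
      have h : |(m - n) k| ≤ 1 := by exact_mod_cast this
      rw [abs_le] at h
      omega
    -- any coordinate with integer difference is k
    have huniq : ∀ i, ∀ z : ℤ, z ≠ 0 → icV α (m - n) i = z → i = k := by
      intro i z hz h
      have h1 := icV_int hα _ i z h
      rcases lt_trichotomy i k with hik | hik | hik
      · have h2 := icV_int hα _ k _ hk'
        exfalso
        apply hz
        have : icV α (m - n) i = 0 := by
          simp only [icV]
          rw [h2 i hik, Finset.sum_eq_zero]
          · simp
          · intro j hj
            rw [h2 j ((Finset.mem_Iio.1 hj).trans hik)]; simp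
        rw [this] at h
        exact_mod_cast h.symm
      · exact hik
      · exact absurd (h1 k hik) hk
    have hlt : ∀ i, i ≠ k → |icV α m i - icV α n i| < 1 := by
      intro i hi
      refine lt_of_le_of_ne (hle i) fun h => ?_
      rw [← icV_sub] at h
      rcases (abs_eq zero_le_one).1 h with h | h
      · exact hi (huniq i 1 one_ne_zero (by simpa using h))
      · exact hi (huniq i (-1) (by norm_num) (by simpa using h))
    obtain ⟨p, hp1, hp2, hp3⟩ : ∃ p, p ∈ icQ s (icV α n) ∧ p ∈ icQ s (icV α m) ∧
        p ∈ interior (icQ s (icV α n) ∪ icQ s (icV α m)) := by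
      rw [icV_sub] at hk'
      rcases hkabs with h | h
      · rw [h] at hk'
        push_cast at hk'
        exact ic_mid hs _ _ k (by linarith) hlt
      · rw [h] at hk'
        push_cast at hk'
        obtain ⟨p, a, b, c⟩ := ic_mid hs (icV α m) (icV α n) k (by linarith)
          (fun i hi => by rw [abs_sub_comm]; exact hlt i hi)
        exact ⟨p, b, a, by rwa [union_comm]⟩
    rw [← icA_closure hs] at hp1 hp2
    rw [← icA_closure hs, ← icA_closure hs] at hp3
    exact ic_union hA hB iA iB hp1 hp2 hp3
end
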